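/- Fix p0 ∈ (0,2), γ ∈ (0,1), and α0 ∈ (p0, 2). Define g(α) = ∫_{p0}^2 |R_{α0}(p) − R_α(p)|^γ dp for α ∈ [0,2]. Then there exists a positive constant K, depending only on α0 (and p0, γ), such that g(α) ≥ K |α − α0| for all α ∈ [0,2]. -/

import Mathlib

open MeasureTheory Real Set

/-- `m_α(p)`: the `p`-th absolute moment of a standard symmetric `α`-stable random
variable, `m_α(p) = 2^(p−1) Γ(1 − p/α) / (p ∫_0^∞ u^(−p−1) sin²(u) du)`. -/
noncomputable def mstable (a p : ℝ) : ℝ :=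
  2 ^ (p - 1) * Real.Gamma (1 - p / a) /
    (p * ∫ u in Set.Ioi (0:ℝ), u ^ (-p - 1) * Real.sin u ^ 2)

/-- `R_α(p) = (m_α(p0))^{1/p0} / (m_α(p))^{1/p}` if `p < α`, and `0` otherwise. -/
noncomputable def Rstable (p0 a p : ℝ) : ℝ :=
  if p < a then mstable a p0 ^ (1 / p0) / mstable a p ^ (1 / p) else 0

/-- the sine integral -/
noncomputable def sinInt (p : ℝ) : ℝ := ∫ u in Set.Ioi (0:ℝ), u ^ (-p - 1) * Real.sin u ^ 2

lemma sinInt_aux (p : ℝ) (hp : 0 < p) (hp2 : p < 2) :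
    IntegrableOn (fun u : ℝ => u ^ (-p - 1) * Real.sin u ^ 2) (Ioc 0 1) ∧
    IntegrableOn (fun u : ℝ => u ^ (-p - 1) * Real.sin u ^ 2) (Ioi 1) ∧
    sinInt p ≤ 1 / (2 - p) + 1 / p := by
  have hm : Measurable (fun u : ℝ => u ^ (-p - 1) * Real.sin u ^ 2) := by fun_prop
  have i1 : IntegrableOn (fun u : ℝ => u ^ (1 - p)) (Ioc 0 1) := by
    rw [← intervalIntegrable_iff_integrableOn_Ioc_of_le zero_le_one]
    exact intervalIntegral.intervalIntegrable_rpow' (by linarith)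
  have i2 : IntegrableOn (fun u : ℝ => u ^ (-p - 1)) (Ioi 1) :=
    integrableOn_Ioi_rpow_of_lt (by linarith) one_pos
  have b1 : ∀ u ∈ Ioc (0:ℝ) 1, u ^ (-p - 1) * Real.sin u ^ 2 ≤ u ^ (1 - p) := by
    intro u hu
    have h1 : Real.sin u ^ 2 ≤ u ^ 2 := by
      rw [sq_le_sq]; exact abs_sin_le_abs
    have h2 : u ^ (1 - p) = u ^ (-p - 1) * u ^ 2 := by
      rw [← rpow_natCast u 2, ← rpow_add hu.1]; congr 1; push_cast; ring
    rw [h2]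
    exact mul_le_mul_of_nonneg_left h1 (rpow_nonneg hu.1.le _)
  have b2 : ∀ u ∈ Ioi (1:ℝ), u ^ (-p - 1) * Real.sin u ^ 2 ≤ u ^ (-p - 1) := by
    intro u hu
    have hu0 : (0:ℝ) < u := lt_trans one_pos hu
    exact mul_le_of_le_one_right (rpow_nonneg hu0.le _) (sin_sq_le_one u)
  have j1 : IntegrableOn (fun u : ℝ => u ^ (-p - 1) * Real.sin u ^ 2) (Ioc 0 1) := by
    refine Integrable.mono' i1 hm.aestronglyMeasurable ?_
    refine (ae_restrict_iff' measurableSet_Ioc).2 (Filter.Eventually.of_forall fun u hu => ?_)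
    rw [norm_of_nonneg (mul_nonneg (rpow_nonneg hu.1.le _) (sq_nonneg _))]
    exact b1 u hu
  have j2 : IntegrableOn (fun u : ℝ => u ^ (-p - 1) * Real.sin u ^ 2) (Ioi 1) := by
    refine Integrable.mono' i2 hm.aestronglyMeasurable ?_
    refine (ae_restrict_iff' measurableSet_Ioi).2 (Filter.Eventually.of_forall fun u hu => ?_)
    have hu0 : (0:ℝ) < u := lt_trans one_pos hu
    rw [norm_of_nonneg (mul_nonneg (rpow_nonneg hu0.le _) (sq_nonneg _))]
    exact b2 u hu
  refine ⟨j1, j2, ?_⟩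
  unfold sinInt
  rw [← Ioc_union_Ioi_eq_Ioi (zero_le_one' ℝ),
    setIntegral_union (Ioc_disjoint_Ioi le_rfl) measurableSet_Ioi j1 j2]
  have e1 : ∫ u in Ioc (0:ℝ) 1, u ^ (1 - p) = 1 / (2 - p) := by
    rw [← intervalIntegral.integral_of_le zero_le_one, integral_rpow (Or.inl (by linarith)),
      one_rpow, zero_rpow (by linarith)]
    congr 1 <;> ring
  have e2 : ∫ u in Ioi (1:ℝ), u ^ (-p - 1) = 1 / p := by
    rw [integral_Ioi_rpow_of_lt (by linarith) one_pos, one_rpow]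
    have e : -p - 1 + 1 = -p := by ring
    rw [e, neg_div_neg_eq]
  have k1 := setIntegral_mono_on j1 i1 measurableSet_Ioc b1
  have k2 := setIntegral_mono_on j2 i2 measurableSet_Ioi b2
  linarith

lemma sinInt_pos (p : ℝ) (hp : 0 < p) (hp2 : p < 2) : 0 < sinInt p := by
  obtain ⟨j1, j2, -⟩ := sinInt_aux p hp hp2
  have j : IntegrableOn (fun u : ℝ => u ^ (-p - 1) * Real.sin u ^ 2) (Ioi 0) := by
    rw [← Ioc_union_Ioi_eq_Ioi (zero_le_one' ℝ)]; exact j1.union j2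
  unfold sinInt
  rw [setIntegral_pos_iff_support_of_nonneg_ae _ j]
  · refine lt_of_lt_of_le ?_ (measure_mono (s := Ioo (0:ℝ) 1) ?_)
    · simp
    · intro u hu
      refine ⟨?_, hu.1⟩
      have : 0 < Real.sin u := sin_pos_of_pos_of_lt_pi hu.1 (by linarith [hu.2, pi_gt_three])
      have := rpow_pos_of_pos hu.1 (-p - 1)
      simp only [Function.mem_support]
      positivity
  · refine (ae_restrict_iff' measurableSet_Ioi).2 (Filter.Eventually.of_forall fun u hu => ?_)
    exact mul_nonneg (rpow_nonneg (le_of_lt hu) _) (sq_nonneg _)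

lemma sinInt_measurable : Measurable sinInt := by
  have : StronglyMeasurable (Function.uncurry
      (fun p u : ℝ => u ^ (-p - 1) * Real.sin u ^ 2)) := by
    apply Measurable.stronglyMeasurable
    unfold Function.uncurry
    fun_prop
  exact (this.integral_prod_right (ν := volume.restrict (Ioi (0:ℝ)))).measurable

lemma gammaInt_measurable :
    Measurable (fun s : ℝ => ∫ x in Ioi (0:ℝ), Real.exp (-x) * x ^ (s - 1)) := by
  have : StronglyMeasurable (Function.uncurry
      (fun s x : ℝ => Real.exp (-x) * x ^ (s - 1))) := by
    apply Measurable.stronglyMeasurable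
    unfold Function.uncurry
    fun_prop
  exact (this.integral_prod_right (ν := volume.restrict (Ioi (0:ℝ)))).measurable

lemma one_sub_pos {a p : ℝ} (ha : 0 ≤ a) (h : p < a) : 0 < 1 - p / a := by
  rcases ha.eq_or_lt with rfl | ha
  · simp
  · rw [sub_pos, div_lt_one ha]; exact h

lemma Rstable_measurable (p0 a : ℝ) (ha : 0 ≤ a) : Measurable (Rstable p0 a) := by
  have : Rstable p0 a = fun p => if p < a then mstable a p0 ^ (1 / p0) /
      (2 ^ (p - 1) * (∫ x in Ioi (0:ℝ), Real.exp (-x) * x ^ ((1 - p / a) - 1)) /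
        (p * sinInt p)) ^ (1 / p) else 0 := by
    funext p
    unfold Rstable
    split_ifs with h
    · rw [← Real.Gamma_eq_integral (one_sub_pos ha h)]; rfl
    · rfl
  rw [this]
  have h1 := gammaInt_measurable.comp (f := fun p : ℝ => 1 - p / a) (by fun_prop)
  have h2 := sinInt_measurable
  simp only [Function.comp_def] at h1
  refine Measurable.ite measurableSet_Iio ?_ measurable_const
  fun_prop

lemma mstable_pos {a p : ℝ} (hp : 0 < p) (hpa : p < a) (ha : a ≤ 2) : 0 < mstable a p := by
  have h1 := sinInt_pos p hp (by linarith)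
  have h2 := Real.Gamma_pos_of_pos (one_sub_pos (by linarith) hpa)
  have h3 : (0:ℝ) < 2 ^ (p - 1) := rpow_pos_of_pos two_pos _
  unfold mstable
  unfold sinInt at h1
  positivity

lemma mstable_lower (p0 : ℝ) (hp0 : 0 < p0) : ∃ c : ℝ, 0 < c ∧ c ≤ 1 ∧
    ∀ a p, p0 < p → p < a → a ≤ 2 → c ≤ mstable a p := by
  obtain ⟨x, hx, hmin⟩ := (isCompact_Icc (a := (1:ℝ)) (b := 2)).exists_isMinOn
    (f := Real.Gamma) ⟨1, by simp⟩ (by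
      intro y hy
      refine (Real.differentiableAt_Gamma fun m => ?_).continuousAt.continuousWithinAt
      have := hy.1
      have hm : (0:ℝ) ≤ m := Nat.cast_nonneg m
      intro h
      linarith)
  have hc : 0 < Real.Gamma x := Real.Gamma_pos_of_pos (by linarith [hx.1])
  set c := Real.Gamma x with hcdef
  have hK : 0 < 1 + 2 / p0 := by positivity
  refine ⟨min 1 (c / (2 * (1 + 2 / p0))), by positivity, min_le_left _ _, ?_⟩
  intro a p h1 h2 h3
  refine (min_le_right _ _).trans ?_
  have hp : 0 < p := hp0.trans h1
  have ha : 0 < a := hp.trans h2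
  have hp2 : p < 2 := by linarith
  have hI := sinInt_pos p hp hp2
  have hI2 := (sinInt_aux p hp hp2).2.2
  have hy := one_sub_pos ha.le h2
  have hpa : p / 2 ≤ p / a := div_le_div_of_nonneg_left hp.le ha h3
  have hpa0 : 0 < p / a := by positivity
  have hG : Real.Gamma (1 - p / a) * (1 - p / a) ≥ c := by
    rw [mul_comm, ← Real.Gamma_add_one hy.ne']
    exact hmin ⟨by linarith, by linarith⟩
  have hGpos := Real.Gamma_pos_of_pos hy
  have hG2 : c ≤ Real.Gamma (1 - p / a) * ((2 - p) / 2) := by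
    refine hG.le.trans (mul_le_mul_of_nonneg_left (by linarith) hGpos.le)
  have hI3 : sinInt p * (2 - p) ≤ 1 + 2 / p0 := by
    have h2p : 0 < 2 - p := by linarith
    calc sinInt p * (2 - p) ≤ (1 / (2 - p) + 1 / p) * (2 - p) :=
          mul_le_mul_of_nonneg_right hI2 h2p.le
      _ = 1 + (2 - p) / p := by field_simp
      _ ≤ 1 + 2 / p0 := by
          have : (2 - p) / p ≤ 2 / p0 := by
            apply div_le_div₀ <;> linarith
          linarith
  have h2pow : (1:ℝ) / 2 ≤ 2 ^ (p - 1) := by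
    have : (2:ℝ) ^ (-1:ℝ) ≤ 2 ^ (p - 1) := rpow_le_rpow_of_exponent_le one_le_two (by linarith)
    rw [rpow_neg_one] at this; linarith
  change _ ≤ 2 ^ (p - 1) * Real.Gamma (1 - p / a) / (p * sinInt p)
  rw [div_le_div_iff₀ (by positivity) (by positivity)]
  set G := Real.Gamma (1 - p / a)
  calc c * (p * sinInt p) ≤ (G * ((2 - p) / 2)) * (2 * sinInt p) := by
        gcongr
    _ = G * (sinInt p * (2 - p)) := by ring
    _ ≤ G * (1 + 2 / p0) := by gcongr
    _ = 1 / 2 * G * (2 * (1 + 2 / p0)) := by ring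
    _ ≤ 2 ^ (p - 1) * G * (2 * (1 + 2 / p0)) := by gcongr

lemma Rstable_nonneg {p0 a p : ℝ} (hp0 : 0 < p0) (hp : p0 < p) (ha : a ≤ 2) :
    0 ≤ Rstable p0 a p := by
  unfold Rstable
  split_ifs with h
  · have h1 := mstable_pos hp0 (hp.trans h) ha
    have h2 := mstable_pos (hp0.trans hp) h ha
    positivity
  · rfl

lemma Rstable_pos {p0 a p : ℝ} (hp0 : 0 < p0) (hp : p0 < p) (h : p < a) (ha : a ≤ 2) :
    0 < Rstable p0 a p := by
  unfold Rstable
  rw [if_pos h]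
  have h1 := mstable_pos hp0 (hp.trans h) ha
  have h2 := mstable_pos (hp0.trans hp) h ha
  positivity

lemma Rstable_bdd (p0 a : ℝ) (hp0 : 0 < p0) (ha : a ≤ 2) :
    ∃ M, 0 ≤ M ∧ ∀ p, p0 < p → Rstable p0 a p ≤ M := by
  obtain ⟨c, hc, hc1, hb⟩ := mstable_lower p0 hp0
  refine ⟨|mstable a p0 ^ (1 / p0)| / c ^ (1 / p0), by positivity, fun p hp => ?_⟩
  unfold Rstable
  split_ifs with h
  · have hm := hb a p hp h ha
    have hp' := hp0.trans hp
    apply div_le_div₀ (abs_nonneg _) (le_abs_self _) (by positivity)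
    calc c ^ (1 / p0) ≤ c ^ (1 / p) :=
          rpow_le_rpow_of_exponent_ge hc hc1 (one_div_le_one_div_of_le hp0 hp.le)
      _ ≤ mstable a p ^ (1 / p) := rpow_le_rpow hc.le hm (by positivity)
  · positivity

lemma neglog_convex : ConvexOn ℝ (Ioo (0:ℝ) 1) (fun x => -Real.log x - x ^ 2 / 2) := by
  refine convexOn_of_hasDerivWithinAt2_nonneg (f' := fun x => -x⁻¹ - x)
    (f'' := fun x => (x ^ 2)⁻¹ - 1) (convex_Ioo 0 1) ?_ ?_ ?_ ?_
  · intro x hx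
    have := hx.1.ne'
    exact ContinuousAt.continuousWithinAt (by fun_prop (disch := assumption))
  · intro x hx
    rw [interior_Ioo] at hx
    have h := ((Real.hasDerivAt_log hx.1.ne').neg.sub ((hasDerivAt_pow 2 x).div_const 2))
    have e : -x⁻¹ - ((2:ℕ):ℝ) * x ^ (2 - 1) / 2 = -x⁻¹ - x := by
      push_cast; ring
    rw [e] at h
    exact h.hasDerivWithinAt
  · intro x hx
    rw [interior_Ioo] at hx
    have h := (hasDerivAt_inv hx.1.ne').neg.sub (hasDerivAt_id x)
    rw [neg_neg] at h
    exact h.hasDerivWithinAt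
  · intro x hx
    rw [interior_Ioo] at hx
    rw [sub_nonneg]
    apply (one_le_inv₀ (by have := hx.1; positivity)).2
    have := hx.1; have := hx.2; nlinarith

lemma logGamma_convex : ConvexOn ℝ (Ioo (0:ℝ) 1)
    (fun x => Real.log (Real.Gamma x) - x ^ 2 / 2) := by
  have h1 : ConvexOn ℝ (Ioo (0:ℝ) 1) (fun x => Real.log (Real.Gamma (x + 1))) := by
    have := Real.convexOn_log_Gamma.translate_left 1
    refine ConvexOn.subset this ?_ (convex_Ioo 0 1)
    intro x hx
    have := hx.1
    simp only [mem_preimage, mem_Ioi]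
    linarith
  refine (h1.add neglog_convex).congr ?_
  intro x hx
  have h0 := hx.1
  simp only [Pi.add_apply]
  rw [Real.Gamma_add_one h0.ne', Real.log_mul h0.ne' (Real.Gamma_pos_of_pos h0).ne']
  ring

/-- the key strict monotonicity estimate -/
lemma key {p0 p a b : ℝ} (hp0 : 0 < p0) (hp : p0 < p) (ha : p < a) (hab : a < b) (hb : b ≤ 2) :
    (b - a) * (p - p0) / 8 ≤
      ((1 / p0) * Real.log (Real.Gamma (1 - p0 / b)) - (1 / p) * Real.log (Real.Gamma (1 - p / b)))
      - ((1 / p0) * Real.log (Real.Gamma (1 - p0 / a))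
        - (1 / p) * Real.log (Real.Gamma (1 - p / a))) := by
  have hp' := hp0.trans hp
  have ha0 := hp'.trans ha
  have hb0 := ha0.trans hab
  obtain ⟨s, hs⟩ : ∃ s, s = 1 / a := ⟨_, rfl⟩
  obtain ⟨t, ht⟩ : ∃ t, t = 1 / b := ⟨_, rfl⟩
  have e1 : p0 / b = p0 * t := by rw [ht]; ring
  have e2 : p / b = p * t := by rw [ht]; ring
  have e3 : p0 / a = p0 * s := by rw [hs]; ring
  have e4 : p / a = p * s := by rw [hs]; ring
  have hts : t < s := by rw [hs, ht]; exact one_div_lt_one_div_of_lt ha0 hab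
  have ht2 : 1 / 2 ≤ t := by rw [ht]; exact one_div_le_one_div_of_le hb0 hb
  have hps : p * s < 1 := by rw [← e4, div_lt_one ha0]; exact ha
  have hst : (b - a) / 4 ≤ s - t := by
    have : s - t = (b - a) / (a * b) := by rw [hs, ht]; field_simp
    rw [this]
    apply div_le_div_of_nonneg_left (by linarith) (by positivity)
    nlinarith
  rw [e1, e2, e3, e4]
  have m1 : p0 * t < p0 * s := mul_lt_mul_of_pos_left hts hp0
  have m2 : p * t < p * s := mul_lt_mul_of_pos_left hts hp'
  have m3 : p0 * t < p * t := mul_lt_mul_of_pos_right hp (by linarith)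
  have m4 : p0 * s < p * s := mul_lt_mul_of_pos_right hp (by linarith)
  have m5 : 0 < p0 * t := mul_pos hp0 (by linarith)
  have M1 : 1 - p * s ∈ Ioo (0:ℝ) 1 := ⟨by linarith, by linarith⟩
  have M2 : 1 - p * t ∈ Ioo (0:ℝ) 1 := ⟨by linarith, by linarith⟩
  have M3 : 1 - p0 * s ∈ Ioo (0:ℝ) 1 := ⟨by linarith, by linarith⟩
  have M4 : 1 - p0 * t ∈ Ioo (0:ℝ) 1 := ⟨by linarith, by linarith⟩
  have S1 := logGamma_convex.secant_mono M1 M2 M4 (by linarith : 1 - p * s < 1 - p * t).ne'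
    (by linarith : 1 - p * s < 1 - p0 * t).ne' (by linarith)
  have S2 := logGamma_convex.secant_mono M4 M1 M3 (by linarith : 1 - p * s < 1 - p0 * t).ne
    (by linarith : 1 - p0 * s < 1 - p0 * t).ne (by linarith)
  set A := Real.log (Real.Gamma (1 - p * s))
  set B := Real.log (Real.Gamma (1 - p * t))
  set C := Real.log (Real.Gamma (1 - p0 * s))
  set D := Real.log (Real.Gamma (1 - p0 * t))
  have d0 : 0 < s - t := by linarith
  have f1 : (B - (1 - p * t) ^ 2 / 2 - (A - (1 - p * s) ^ 2 / 2)) / (1 - p * t - (1 - p * s))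
      = (1 / p * (B - A)) / (s - t) - (1 - p * (s + t) / 2) := by
    have : 1 - p * t - (1 - p * s) = p * (s - t) := by ring
    rw [this]; field_simp; ring
  have f2 : (C - (1 - p0 * s) ^ 2 / 2 - (D - (1 - p0 * t) ^ 2 / 2)) / (1 - p0 * s - (1 - p0 * t))
      = (1 / p0 * (D - C)) / (s - t) - (1 - p0 * (s + t) / 2) := by
    have : 1 - p0 * s - (1 - p0 * t) = - (p0 * (s - t)) := by ring
    rw [this]; field_simp; ring
  rw [← neg_div_neg_eq, neg_sub, neg_sub] at S2
  have S4 := S1.trans S2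
  rw [f1, f2] at S4
  have S5 : (p - p0) / 2 ≤ (1 / p0 * (D - C) - 1 / p * (B - A)) / (s - t) := by
    rw [sub_div (1 / p0 * (D - C))]
    have : (p - p0) * 1 ≤ (p - p0) * (s + t) :=
      mul_le_mul_of_nonneg_left (by linarith) (by linarith)
    linarith
  rw [le_div_iff₀ d0] at S5
  have : (b - a) * (p - p0) / 8 ≤ (p - p0) / 2 * (s - t) := by nlinarith
  linarith

lemma Rstable_exp {p0 a p : ℝ} (hp0 : 0 < p0) (hp : p0 < p) (h : p < a) (ha : a ≤ 2) :
    Rstable p0 a p = Real.exp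
      (((1 / p0) * Real.log (2 ^ (p0 - 1) / (p0 * sinInt p0))
        - (1 / p) * Real.log (2 ^ (p - 1) / (p * sinInt p))) +
       ((1 / p0) * Real.log (Real.Gamma (1 - p0 / a))
        - (1 / p) * Real.log (Real.Gamma (1 - p / a)))) := by
  have hl : ∀ q, 0 < q → q < a → Real.log (mstable a q) =
      Real.log (2 ^ (q - 1) / (q * sinInt q)) + Real.log (Real.Gamma (1 - q / a)) := by
    intro q hq hqa
    have h1 := sinInt_pos q hq (by linarith)
    have h2 := Real.Gamma_pos_of_pos (one_sub_pos (by linarith) hqa)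
    have h3 : (0:ℝ) < 2 ^ (q - 1) := rpow_pos_of_pos two_pos _
    rw [← Real.log_mul (by positivity) (by positivity)]
    congr 1
    change 2 ^ (q - 1) * Real.Gamma (1 - q / a) / (q * sinInt q) = _
    ring
  have h1 := mstable_pos hp0 (hp.trans h) ha
  have h2 := mstable_pos (hp0.trans hp) h ha
  unfold Rstable
  rw [if_pos h, rpow_def_of_pos h1, rpow_def_of_pos h2, ← Real.exp_sub,
    hl p0 hp0 (hp.trans h), hl p (hp0.trans hp) h]
  congr 1
  ring

lemma Rstable_ratio {p0 p a b : ℝ} (hp0 : 0 < p0) (hp : p0 < p) (ha : p < a) (hab : a < b)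
    (hb : b ≤ 2) :
    Rstable p0 a p * Real.exp ((b - a) * (p - p0) / 8) ≤ Rstable p0 b p := by
  rw [Rstable_exp hp0 hp ha (by linarith), Rstable_exp hp0 hp (ha.trans hab) hb, ← Real.exp_add]
  apply Real.exp_le_exp.2
  linarith [key hp0 hp ha hab hb]

lemma one_sub_exp {x : ℝ} (h0 : 0 ≤ x) (h1 : x ≤ 1) : Real.exp (-x) ≤ 1 - x / 2 := by
  rw [Real.exp_neg]
  have := Real.add_one_le_exp x
  calc (Real.exp x)⁻¹ ≤ (x + 1)⁻¹ := inv_anti₀ (by linarith) this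
    _ ≤ 1 - x / 2 := by
      rw [inv_le_iff_one_le_mul₀ (by linarith)]
      nlinarith

lemma Rstable_diff {p0 p a α0 : ℝ} (hp0 : 0 < p0) (hp : p0 < p) (hp2 : p ≤ 2) (ha : a ≤ 2)
    (ha0 : 0 ≤ a) (hα : 0 ≤ α0) (hα0 : α0 ≤ 2) :
    Rstable p0 α0 p * (p - p0) / 16 * |a - α0| ≤ |Rstable p0 α0 p - Rstable p0 a p| := by
  by_cases h : p < α0
  swap
  · have : Rstable p0 α0 p = 0 := by unfold Rstable; rw [if_neg h]
    rw [this]; simp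
  have hR := Rstable_pos hp0 hp h hα0
  have hd : 0 < p - p0 := by linarith
  rcases lt_trichotomy a α0 with hlt | rfl | hgt
  · rw [abs_of_neg (by linarith : a - α0 < 0)]
    set x := (α0 - a) * (p - p0) / 8 with hx
    have hx0 : 0 ≤ x := by
      have : 0 < α0 - a := by linarith
      positivity
    have hx1 : x ≤ 1 := by
      rw [hx]; nlinarith
    have : Rstable p0 a p ≤ Rstable p0 α0 p * (1 - x / 2) := by
      by_cases hpa : p < a
      · have h1 := Rstable_ratio hp0 hp hpa hlt hα0
        have h2 := one_sub_exp hx0 hx1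
        calc Rstable p0 a p = Rstable p0 a p * Real.exp x * Real.exp (-x) := by
              rw [mul_assoc, ← Real.exp_add]; simp
          _ ≤ Rstable p0 α0 p * Real.exp (-x) := by gcongr
          _ ≤ _ := by gcongr
      · have : Rstable p0 a p = 0 := by unfold Rstable; rw [if_neg hpa]
        rw [this]
        exact mul_nonneg hR.le (by linarith)
    refine le_trans ?_ (le_abs_self _)
    have e : Rstable p0 α0 p * (p - p0) / 16 * -(a - α0) = Rstable p0 α0 p * (x / 2) := by
      rw [hx]; ring
    rw [e]; linarith
  · simp
  · rw [abs_of_pos (by linarith : 0 < a - α0), abs_sub_comm]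
    refine le_trans ?_ (le_abs_self _)
    have h1 := Rstable_ratio hp0 hp h hgt ha
    have h2 := Real.add_one_le_exp ((a - α0) * (p - p0) / 8)
    have h3 := mul_le_mul_of_nonneg_left h2 hR.le
    have h4 : 0 ≤ Rstable p0 α0 p * ((a - α0) * (p - p0)) := by
      have : 0 < a - α0 := by linarith
      positivity
    nlinarith

/-- Fix `p0 ∈ (0,2)`, `γ ∈ (0,1)` and `α0 ∈ (p0,2)`, and let
`g(α) = ∫_{p0}^2 |R_{α0}(p) − R_α(p)|^γ dp`. Then there is a constant `K > 0`
(depending only on `α0`, `p0`, `γ`) with `g(α) ≥ K |α − α0|` for all `α ∈ [0,2]`. -/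
theorem contrast_function_linear_lower_bound (p0 γ α0 : ℝ)
    (hp0 : p0 ∈ Set.Ioo (0:ℝ) 2) (hγ : γ ∈ Set.Ioo (0:ℝ) 1) (hα0 : α0 ∈ Set.Ioo p0 2) :
    ∃ K : ℝ, 0 < K ∧ ∀ a ∈ Set.Icc (0:ℝ) 2,
      K * |a - α0| ≤ ∫ p in p0..2, |Rstable p0 α0 p - Rstable p0 a p| ^ γ := by
  obtain ⟨h0, h2⟩ := hp0
  obtain ⟨hg0, hg1⟩ := hγ
  obtain ⟨hα1, hα2⟩ := hα0
  have hαpos : 0 < α0 := h0.trans hα1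
  have hmα := Rstable_measurable p0 α0 hαpos.le
  obtain ⟨M, hM0, hM⟩ := Rstable_bdd p0 α0 h0 hα2.le
  set w : ℝ → ℝ := fun p => (Rstable p0 α0 p * (p - p0) / 16) ^ γ with hw
  have hwi : IntegrableOn w (Ioc p0 2) := by
    refine Measure.integrableOn_of_bounded (M := (M * 2 / 16) ^ γ) (by simp)
      (Measurable.aestronglyMeasurable (by fun_prop)) ?_
    refine (ae_restrict_iff' measurableSet_Ioc).2 (Filter.Eventually.of_forall fun p hp => ?_)
    have hR := Rstable_nonneg h0 hp.1 hα2.le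
    have hRM := hM p hp.1
    have hd : 0 ≤ p - p0 := by linarith [hp.1]
    have hd2 : p - p0 ≤ 2 := by linarith [hp.2]
    rw [norm_of_nonneg (by positivity)]
    simp only [hw]
    gcongr
  have hwpos : 0 < ∫ p in Ioc p0 2, w p := by
    rw [setIntegral_pos_iff_support_of_nonneg_ae _ hwi]
    · refine lt_of_lt_of_le ?_ (measure_mono (s := Ioo p0 α0) ?_)
      · simpa using hα1
      · intro p hp
        refine ⟨?_, hp.1, by linarith [hp.2]⟩
        have hR := Rstable_pos h0 hp.1 hp.2 hα2.le
        have hd : 0 < p - p0 := by linarith [hp.1]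
        simp only [Function.mem_support, hw]
        positivity
    · refine (ae_restrict_iff' measurableSet_Ioc).2 (Filter.Eventually.of_forall fun p hp => ?_)
      have hR := Rstable_nonneg h0 hp.1 hα2.le
      have hd : 0 ≤ p - p0 := by linarith [hp.1]
      simp only [hw, Pi.zero_apply]
      positivity
  refine ⟨(∫ p in Ioc p0 2, w p) / 2, by positivity, ?_⟩
  intro a ha
  obtain ⟨ha0, ha2⟩ := ha
  have hma := Rstable_measurable p0 a ha0
  obtain ⟨N, hN0, hN⟩ := Rstable_bdd p0 a h0 ha2
  have hgi : IntegrableOn (fun p => |Rstable p0 α0 p - Rstable p0 a p| ^ γ) (Ioc p0 2) := by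
    refine Measure.integrableOn_of_bounded (M := (M + N) ^ γ) (by simp)
      (Measurable.aestronglyMeasurable (by fun_prop)) ?_
    refine (ae_restrict_iff' measurableSet_Ioc).2 (Filter.Eventually.of_forall fun p hp => ?_)
    have hR := Rstable_nonneg h0 hp.1 hα2.le
    have hRM := hM p hp.1
    have hR' := Rstable_nonneg h0 hp.1 ha2
    have hRN := hN p hp.1
    rw [norm_of_nonneg (by positivity)]
    refine rpow_le_rpow (abs_nonneg _) ?_ hg0.le
    rw [abs_le]; constructor <;> linarith
  rw [intervalIntegral.integral_of_le h2.le]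
  have hx : |a - α0| / 2 ≤ |a - α0| ^ γ := by
    have hle : |a - α0| / 2 ≤ 1 := by
      have : |a - α0| ≤ 2 := by rw [abs_le]; constructor <;> linarith
      linarith
    have hnn : 0 ≤ |a - α0| / 2 := by positivity
    rcases hnn.eq_or_lt with h | h
    · rw [← h]; positivity
    calc |a - α0| / 2 = (|a - α0| / 2) ^ (1:ℝ) := (rpow_one _).symm
      _ ≤ (|a - α0| / 2) ^ γ := rpow_le_rpow_of_exponent_ge h hle hg1.le
      _ ≤ |a - α0| ^ γ := rpow_le_rpow hnn (by linarith) hg0.le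
  calc (∫ p in Ioc p0 2, w p) / 2 * |a - α0| = (∫ p in Ioc p0 2, w p) * (|a - α0| / 2) := by ring
    _ ≤ (∫ p in Ioc p0 2, w p) * |a - α0| ^ γ := by gcongr
    _ = ∫ p in Ioc p0 2, w p * |a - α0| ^ γ := (integral_mul_const _ _).symm
    _ ≤ _ := by
      refine setIntegral_mono_on (hwi.mul_const _) hgi measurableSet_Ioc fun p hp => ?_
      have hR := Rstable_nonneg h0 hp.1 hα2.le
      have hd : 0 ≤ p - p0 := by linarith [hp.1]
      simp only [hw]
      rw [← mul_rpow (by positivity) (abs_nonneg _)]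
      exact rpow_le_rpow (by positivity)
        (Rstable_diff h0 hp.1 hp.2 ha2 ha0 hαpos.le hα2.le) hg0.le
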